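/- There exists ε₀ > 0 such that for every ε ∈ (0,ε₀) there exists C₀ such that for every C ≥ C₀ there exists N with: for all n ≥ N, for any maximum choices of K2(G) and K3(G), every G ∈ 𝓕(n)∖(X0(n)∪X1(n)∪X2(n)∪X3(n)) satisfies that G−(K1(G)∪K2(G)∪K3(G)) is blue-bipartite; in particular κ(G) ≤ κ1(G) + 2κ2(G) + 2κ3(G), where X_i(n)=X_i(n,s) with s=⌈C·log n⌉. -/

import Mathlib

open Filter

noncomputable section

/-- A colored graph on `Fin n`: a simple graph whose edges are partitioned
into red and blue edges. -/
structure ColoredGraph (n : ℕ) where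
  red : SimpleGraph (Fin n)
  blue : SimpleGraph (Fin n)
  disj : ∀ x y, ¬ (red.Adj x y ∧ blue.Adj x y)

namespace ColoredGraph

variable {n : ℕ}

/-- The underlying (uncolored) simple graph. -/
def graph (G : ColoredGraph n) : SimpleGraph (Fin n) := G.red ⊔ G.blue

/-- Adjacency in a colored graph. -/
def Adj (G : ColoredGraph n) (x y : Fin n) : Prop := G.graph.Adj x y

/-- The neighborhood of a vertex. -/
def nbhd (G : ColoredGraph n) (x : Fin n) : Set (Fin n) := {y | G.Adj x y}

/-- `Γ(Q)`, the external neighborhood of a set of vertices. -/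
def nbhdSet (G : ColoredGraph n) (Q : Set (Fin n)) : Set (Fin n) :=
  (⋃ x ∈ Q, G.nbhd x) \ Q

/-- The degree of a vertex. -/
def deg (G : ColoredGraph n) (x : Fin n) : ℕ := (G.nbhd x).ncard

open scoped Classical in
/-- Indicator that the edge `xy` is blue. -/
def blueInd (G : ColoredGraph n) (x y : Fin n) : ℕ := if G.blue.Adj x y then 1 else 0

/-- Odd-blue-triangle-free: no triangle with an odd number of blue edges. -/
def OBTF (G : ColoredGraph n) : Prop :=
  ∀ x y z : Fin n, G.Adj x y → G.Adj y z → G.Adj x z →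
    ¬ Odd (G.blueInd x y + G.blueInd y z + G.blueInd x z)

/-- The colored graph induced on the vertex set `A` is blue-bipartite: there is a
partition `U ⊔ (A \ U)` of `A` such that blue edges within `A` cross the partition
and red edges within `A` do not. -/
def BlueBipartiteOn (G : ColoredGraph n) (A : Set (Fin n)) : Prop :=
  ∃ U ⊆ A, ∀ x ∈ A, ∀ y ∈ A,
    (G.blue.Adj x y → (x ∈ U ↔ y ∉ U)) ∧ (G.red.Adj x y → (x ∈ U ↔ y ∈ U))

/-- Blue-bipartite colored graph. -/
def BlueBipartite (G : ColoredGraph n) : Prop := G.BlueBipartiteOn Set.univ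

/-- `κ(G)`: the minimum size of a vertex set whose removal leaves a blue-bipartite graph. -/
def kappa (G : ColoredGraph n) : ℕ :=
  sInf {k | ∃ K : Set (Fin n), K.ncard = k ∧ G.BlueBipartiteOn Kᶜ}

end ColoredGraph

/-- `𝓕(n)`: the set of OBTF colored graphs on `[n]`. -/
def obtfSet (n : ℕ) : Set (ColoredGraph n) := {G | G.OBTF}

/-- `F(n) = |𝓕(n)|`. -/
def Fnum (n : ℕ) : ℕ := (obtfSet n).ncard

/-- `𝓑(n)`: the set of blue-bipartite colored graphs on `[n]`. -/
def bbSet (n : ℕ) : Set (ColoredGraph n) := {G | G.BlueBipartite}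

/-- `|𝓑(n)|`. -/
def Bnum (n : ℕ) : ℕ := (bbSet n).ncard

/-- `b(n) = 2^{n(n+1)/2 - 1}`. -/
def bnum (n : ℕ) : ℕ := 2 ^ (n * (n + 1) / 2 - 1)

/-- The binary entropy function (logarithms base 2). -/
def binH (x : ℝ) : ℝ := -x * Real.logb 2 x - (1 - x) * Real.logb 2 (1 - x)

/-- `K1(G)`: the set of vertices of degree less than `ε n`. -/
def K1 {n : ℕ} (G : ColoredGraph n) (ε : ℝ) : Set (Fin n) :=
  {x | (G.deg x : ℝ) < ε * n}

/-- `κ1(G) = |K1(G)|`. -/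
def kappa1 {n : ℕ} (G : ColoredGraph n) (ε : ℝ) : ℕ := (K1 G ε).ncard

/-- `X1(n,t)`: OBTF graphs with `κ1(G) ≥ t`. -/
def X1set (n t : ℕ) (ε : ℝ) : Set (ColoredGraph n) :=
  {G ∈ obtfSet n | t ≤ kappa1 G ε}

/-- `X0(n,t)`: OBTF graphs on `[n]` having a `t`-set of vertices `Q` with
`|Γ(Q)| < 0.6 n`. -/
def X0set (n t : ℕ) : Set (ColoredGraph n) :=
  {G ∈ obtfSet n | ∃ Q : Set (Fin n), Q.ncard = t ∧ ((G.nbhdSet Q).ncard : ℝ) < 0.6 * n}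

/-- A collection witnessing `κ2(G) ≥ l`: `2l` distinct vertices
`x_1,…,x_l,y_1,…,y_l ∈ [n] ∖ K1(G)` with `|Γ(x_i) ∩ Γ(y_i)| < ε n` for all `i`. -/
def IsK2Coll {n : ℕ} (G : ColoredGraph n) (ε : ℝ) (l : ℕ)
    (f : Fin l ⊕ Fin l → Fin n) : Prop :=
  Function.Injective f ∧ (∀ v, f v ∉ K1 G ε) ∧
    ∀ i : Fin l, ((G.nbhd (f (Sum.inl i)) ∩ G.nbhd (f (Sum.inr i))).ncard : ℝ) < ε * n

/-- `κ2(G)`: the largest `l` admitting a collection as above. -/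
def kappa2 {n : ℕ} (G : ColoredGraph n) (ε : ℝ) : ℕ :=
  sSup {l | ∃ f : Fin l ⊕ Fin l → Fin n, IsK2Coll G ε l f}

/-- `X2(n,t)`: graphs in `𝓕(n) ∖ (X0(n) ∪ X1(n))` with `κ2(G) ≥ t`,
where `X0(n) = X0(n,s)`, `X1(n) = X1(n,s)`, `s = ⌈C log₂ n⌉`. -/
def X2set (n t : ℕ) (ε C : ℝ) : Set (ColoredGraph n) :=
  {G ∈ obtfSet n \ (X0set n ⌈C * Real.logb 2 n⌉₊ ∪ X1set n ⌈C * Real.logb 2 n⌉₊ ε) |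
    t ≤ kappa2 G ε}

/-- `K` is the vertex set of a maximum collection as in the definition of `κ2(G)`. -/
def IsMaxK2 {n : ℕ} (G : ColoredGraph n) (ε : ℝ) (K : Set (Fin n)) : Prop :=
  ∃ f : Fin (kappa2 G ε) ⊕ Fin (kappa2 G ε) → Fin n,
    IsK2Coll G ε (kappa2 G ε) f ∧ Set.range f = K

/-- `I(x,Q_x)`: vertices `z` for which there are `x₁, x₂ ∈ Q_x` with
`x, x₁, z, x₂` a 4-cycle of `G` having an odd number of blue edges. -/
def Iset {n : ℕ} (G : ColoredGraph n) (x : Fin n) (Q : Set (Fin n)) : Set (Fin n) :=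
  {z | ∃ x1 ∈ Q, ∃ x2 ∈ Q,
    ([x, x1, z, x2] : List (Fin n)).Pairwise (· ≠ ·) ∧
    G.Adj x x1 ∧ G.Adj x1 z ∧ G.Adj z x2 ∧ G.Adj x2 x ∧
    Odd (G.blueInd x x1 + G.blueInd x1 z + G.blueInd z x2 + G.blueInd x2 x)}

/-- `I(x,Q_x,y,Q_y)`: vertices in `I(x,Q_x) ∪ I(y,Q_y)`, together with those `z`
for which there are `x₁ ∈ Q_x`, `y₁ ∈ Q_y` with `x, x₁, z, y₁, y` a 5-cycle of `G`
having an odd number of blue edges. -/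
def Iset2 {n : ℕ} (G : ColoredGraph n) (x y : Fin n) (Qx Qy : Set (Fin n)) :
    Set (Fin n) :=
  Iset G x Qx ∪ Iset G y Qy ∪
    {z | ∃ x1 ∈ Qx, ∃ y1 ∈ Qy,
      ([x, x1, z, y1, y] : List (Fin n)).Pairwise (· ≠ ·) ∧
      G.Adj x x1 ∧ G.Adj x1 z ∧ G.Adj z y1 ∧ G.Adj y1 y ∧ G.Adj y x ∧
      Odd (G.blueInd x x1 + G.blueInd x1 z + G.blueInd z y1 + G.blueInd y1 y +
        G.blueInd y x)}

/-- A collection witnessing `κ3(G) ≥ l` (relative to a choice `K2` of `K2(G)`):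
`2l` distinct vertices `x_1,…,x_l,y_1,…,y_l ∈ [n] ∖ (K1(G) ∪ K2)` with `x_i ∼ y_i`,
together with sets `Q_v ⊆ Γ(v)` avoiding the collection, of size `⌈log₂ n⌉`, whose
neighborhoods cover all but `2n^{1-ε}` of `[n] ∖ (K1(G) ∪ K2)`, and with
`|I(x_i, Q_{x_i}, y_i, Q_{y_i})| > ε n` for all `i`. -/
def IsK3Coll {n : ℕ} (G : ColoredGraph n) (ε : ℝ) (K2 : Set (Fin n)) (l : ℕ)
    (f : Fin l ⊕ Fin l → Fin n) (Q : Fin l ⊕ Fin l → Set (Fin n)) : Prop :=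
  Function.Injective f ∧ (∀ v, f v ∉ K1 G ε ∪ K2) ∧
    (∀ i : Fin l, G.Adj (f (Sum.inl i)) (f (Sum.inr i))) ∧
    (∀ v, Q v ⊆ G.nbhd (f v) \ Set.range f) ∧
    (∀ v, (Q v).ncard = ⌈Real.logb 2 n⌉₊) ∧
    (∀ v, ((Set.univ \ (K1 G ε ∪ K2 ∪ G.nbhdSet (Q v))).ncard : ℝ) <
      2 * (n : ℝ) ^ ((1 : ℝ) - ε)) ∧
    ∀ i : Fin l,
      ε * n <
        ((Iset2 G (f (Sum.inl i)) (f (Sum.inr i)) (Q (Sum.inl i)) (Q (Sum.inr i))).ncard : ℝ)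

/-- `κ3(G)` (relative to a choice `K2` of `K2(G)`). -/
def kappa3 {n : ℕ} (G : ColoredGraph n) (ε : ℝ) (K2 : Set (Fin n)) : ℕ :=
  sSup {l | ∃ f Q, IsK3Coll G ε K2 l f Q}

/-- `X3(n,t)`: graphs in `𝓕(n) ∖ (X0(n) ∪ X1(n) ∪ X2(n))` with `κ3(G) ≥ t`,
relative to a choice `K2c` of `K2(G)` for each `G`; here `s = ⌈C log₂ n⌉`. -/
def X3set (n t : ℕ) (ε C : ℝ) (K2c : ColoredGraph n → Set (Fin n)) :
    Set (ColoredGraph n) :=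
  {G ∈ obtfSet n \
      (X0set n ⌈C * Real.logb 2 n⌉₊ ∪ X1set n ⌈C * Real.logb 2 n⌉₊ ε ∪
        X2set n ⌈C * Real.logb 2 n⌉₊ ε C) |
    t ≤ kappa3 G ε (K2c G)}

/-- `K` is the vertex set of a maximum collection as in the definition of `κ3(G)`
(relative to a choice `K2` of `K2(G)`). -/
def IsMaxK3 {n : ℕ} (G : ColoredGraph n) (ε : ℝ) (K2 K : Set (Fin n)) : Prop :=
  ∃ (f : Fin (kappa3 G ε K2) ⊕ Fin (kappa3 G ε K2) → Fin n)
    (Q : Fin (kappa3 G ε K2) ⊕ Fin (kappa3 G ε K2) → Set (Fin n)),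
    IsK3Coll G ε K2 (kappa3 G ε K2) f Q ∧ Set.range f = K



lemma numerics (ε C : ℝ) (hε : 0 < ε) (hε1 : ε < 1 / 100) (hC : 1 ≤ C) :
    ∃ N : ℕ, ∀ n : ℕ, N ≤ n → 0 < n ∧ 2 ≤ ⌈Real.logb 2 n⌉₊ ∧ 1 ≤ ⌈C * Real.logb 2 n⌉₊ ∧
      ((100 * (⌈C * Real.logb 2 n⌉₊ + 2) * (⌈Real.logb 2 n⌉₊ + 2) : ℕ) : ℝ) ≤ ε * n / 10 ∧
      (n : ℝ) * (1 - 9 / 10 * ε) ^ (⌈Real.logb 2 n⌉₊ - 2) + (⌈Real.logb 2 n⌉₊ : ℝ)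
        < 2 * (n : ℝ) ^ ((1 : ℝ) - ε) ∧
      4 * (n : ℝ) ^ ((1 : ℝ) - ε) ≤ ε * n := by
  have hl2 : 0 < Real.log 2 := Real.log_pos (by norm_num)
  have hl2' := Real.log_two_lt_d9
  -- asymptotic facts in ℝ
  have e1 : ∀ᶠ x : ℝ in atTop, Real.log x ^ 2 ≤ (ε / (10 * 100 * 16 * C / Real.log 2 ^ 2)) * x := by
    have h := (Real.isLittleO_pow_log_id_atTop (n := 2)).def
      (c := ε / (10 * 100 * 16 * C / Real.log 2 ^ 2)) (by positivity)
    filter_upwards [h, eventually_gt_atTop 0] with x hx hx0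
    simpa [abs_of_pos hx0] using hx
  have e2 : ∀ᶠ x : ℝ in atTop, Real.log x ≤ (Real.log 2 / 4) * x ^ (1 - ε) := by
    have h := (isLittleO_log_rpow_atTop (r := 1 - ε) (by linarith)).def
      (c := Real.log 2 / 4) (by positivity)
    filter_upwards [h, eventually_gt_atTop 1] with x hx hx0
    have : 0 < x ^ (1 - ε) := Real.rpow_pos_of_pos (by linarith) _
    rw [Real.norm_eq_abs, Real.norm_eq_abs, abs_of_pos this, abs_of_pos (Real.log_pos hx0)] at hx
    exact hx
  have e3 : ∀ᶠ x : ℝ in atTop, 4 / ε ≤ x ^ ε :=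
    (tendsto_rpow_atTop hε).eventually_ge_atTop _
  have e4 : ∀ᶠ x : ℝ in atTop, Real.log 2 * 100 + 1 ≤ Real.log x :=
    Real.tendsto_log_atTop.eventually_ge_atTop _
  have e5 : ∀ᶠ x : ℝ in atTop, (1:ℝ) < x := eventually_gt_atTop 1
  have hall := (tendsto_natCast_atTop_atTop (R := ℝ)).eventually (e1.and (e2.and (e3.and (e4.and e5))))
  obtain ⟨N, hN⟩ := eventually_atTop.1 hall
  refine ⟨N, fun n hn => ?_⟩
  obtain ⟨h1, h2, h3, h4, h5⟩ := hN n hn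
  have hn0 : (0:ℝ) < n := by linarith
  set y := Real.logb 2 (n:ℝ) with hy
  have hyl : y * Real.log 2 = Real.log n := by
    rw [hy, Real.logb]; field_simp
  have hy100 : 100 ≤ y := by
    by_contra hc
    push Not at hc
    nlinarith
  have hCy : 100 ≤ C * y := by nlinarith
  have hL1 : y ≤ ⌈y⌉₊ := Nat.le_ceil y
  have hL2 : (⌈y⌉₊ : ℝ) < y + 1 := Nat.ceil_lt_add_one (by linarith)
  have hs2 : (⌈C * y⌉₊ : ℝ) < C * y + 1 := Nat.ceil_lt_add_one (by linarith)
  have hs1 : C * y ≤ ⌈C * y⌉₊ := Nat.le_ceil _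
  have hLn : 2 ≤ ⌈y⌉₊ := by
    have : (2:ℝ) ≤ ⌈y⌉₊ := by linarith
    exact_mod_cast this
  have hp : 0 < (n:ℝ) ^ (1 - ε) := Real.rpow_pos_of_pos hn0 _
  have hmul : (n:ℝ) ^ (1 - ε) * (n:ℝ) ^ ε = n := by
    rw [← Real.rpow_add hn0]; simp
  refine ⟨by exact_mod_cast hn0, hLn, ?_, ?_, ?_, ?_⟩
  · have : (1:ℝ) ≤ ⌈C * y⌉₊ := by linarith
    exact_mod_cast this
  · push_cast
    have ha : (⌈C * y⌉₊ : ℝ) + 2 ≤ 4 * (C * y) := by linarith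
    have hb : (⌈y⌉₊ : ℝ) + 2 ≤ 4 * y := by linarith
    have hab : ((⌈C * y⌉₊ : ℝ) + 2) * ((⌈y⌉₊ : ℝ) + 2) ≤ (4 * (C * y)) * (4 * y) :=
      mul_le_mul ha hb (by positivity) (by linarith)
    rw [← hyl] at h1
    have h1' : y ^ 2 * Real.log 2 ^ 2 ≤ (ε * n / (10 * 100 * 16 * C)) * Real.log 2 ^ 2 := by
      calc y ^ 2 * Real.log 2 ^ 2 = (y * Real.log 2) ^ 2 := by ring
        _ ≤ _ := h1
        _ = _ := by field_simp
    have h1'' := le_of_mul_le_mul_right h1' (by positivity)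
    rw [le_div_iff₀ (by positivity)] at h1''
    nlinarith
  · have hA : (1 - 9 / 10 * ε) ^ (⌈y⌉₊ - 2) ≤ (n:ℝ) ^ (-ε) := by
      have hb : 1 - 9 / 10 * ε ≤ Real.exp (-(9 / 10 * ε)) := by
        have := Real.add_one_le_exp (-(9 / 10 * ε)); linarith
      calc (1 - 9 / 10 * ε) ^ (⌈y⌉₊ - 2) ≤ Real.exp (-(9 / 10 * ε)) ^ (⌈y⌉₊ - 2) :=
            pow_le_pow_left₀ (by linarith) hb _
        _ = Real.exp (((⌈y⌉₊ - 2 : ℕ) : ℝ) * (-(9 / 10 * ε))) := by rw [Real.exp_nat_mul]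
        _ ≤ Real.exp (Real.log n * (-ε)) := by
            apply Real.exp_le_exp.2
            rw [Nat.cast_sub hLn]
            push_cast
            rw [← hyl]
            have : y * Real.log 2 ≤ 9 / 10 * ((⌈y⌉₊ : ℝ) - 2) := by nlinarith
            nlinarith
        _ = (n:ℝ) ^ (-ε) := by rw [Real.rpow_def_of_pos hn0]
    have hB : (n:ℝ) * (1 - 9 / 10 * ε) ^ (⌈y⌉₊ - 2) ≤ (n:ℝ) ^ (1 - ε) := by
      calc _ ≤ (n:ℝ) * (n:ℝ) ^ (-ε) := mul_le_mul_of_nonneg_left hA hn0.le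
        _ = _ := by rw [sub_eq_add_neg, Real.rpow_add hn0, Real.rpow_one]
    have hC' : (⌈y⌉₊ : ℝ) < (n:ℝ) ^ (1 - ε) := by
      have : y ≤ (n:ℝ) ^ (1 - ε) / 4 := by
        rw [← hyl] at h2
        have : y * Real.log 2 ≤ ((n:ℝ) ^ (1 - ε) / 4) * Real.log 2 := by linarith
        exact le_of_mul_le_mul_right this hl2
      linarith
    linarith
  · rw [div_le_iff₀ hε] at h3
    calc 4 * (n:ℝ) ^ (1 - ε) ≤ ((n:ℝ) ^ ε * ε) * (n:ℝ) ^ (1 - ε) :=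
          mul_le_mul_of_nonneg_right h3 hp.le
      _ = ε * ((n:ℝ) ^ (1 - ε) * (n:ℝ) ^ ε) := by ring
      _ = ε * n := by rw [hmul]

/-! ### Signs -/

/-- sign in ZMod 2 -/
def cz {n : ℕ} (G : ColoredGraph n) (x y : Fin n) : ZMod 2 := (G.blueInd x y : ZMod 2)

lemma cz_symm {n : ℕ} (G : ColoredGraph n) (x y : Fin n) : cz G x y = cz G y x := by
  unfold cz ColoredGraph.blueInd
  by_cases h : G.blue.Adj x y
  · simp [h, h.symm]
  · have h' : ¬ G.blue.Adj y x := fun h2 => h h2.symm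
    simp [h, h']

lemma adj_symm {n : ℕ} {G : ColoredGraph n} {x y : Fin n} (h : G.Adj x y) : G.Adj y x :=
  SimpleGraph.Adj.symm h

lemma adj_ne {n : ℕ} {G : ColoredGraph n} {x y : Fin n} (h : G.Adj x y) : x ≠ y :=
  SimpleGraph.Adj.ne h

lemma z2_ne {a : ZMod 2} (h : a ≠ 0) : a = 1 := by
  revert a; decide

lemma z2_add {a b : ZMod 2} (h : a + b = 0) : a = b := by
  revert a b; decide

lemma tri {n : ℕ} {G : ColoredGraph n} (hG : G.OBTF) {x y z : Fin n} (hxy : G.Adj x y)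
    (hyz : G.Adj y z) (hxz : G.Adj x z) : cz G x y + cz G y z = cz G x z := by
  have h := hG x y z hxy hyz hxz
  rw [← ZMod.natCast_eq_one_iff_odd] at h
  push_cast at h
  have h2 : cz G x y + cz G y z + cz G x z = 0 := by
    by_contra hc
    exact h (z2_ne hc)
  exact z2_add h2

/-! ### A covering lemma -/

open scoped Classical in
lemma greedy_cover {α : Type*} [Fintype α] (r : α → α → Prop) (U Z : Finset α) (p N : ℝ)
    (hp : 0 < p) (hp1 : p ≤ 1) (hN : 0 < N) (hU : (U.card : ℝ) ≤ N)
    (hZ : ∀ z ∈ Z, p * N ≤ ((U.filter (fun q => r q z)).card : ℝ)) (k : ℕ) :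
    ∃ Q ⊆ U, Q.card ≤ k ∧
      ((Z.filter (fun z => ∀ q ∈ Q, ¬ r q z)).card : ℝ) ≤ Z.card * (1 - p) ^ k := by
  induction k with
  | zero =>
    refine ⟨∅, by simp, by simp, ?_⟩
    simp
  | succ k ih =>
    obtain ⟨Q, hQU, hQk, hQ⟩ := ih
    set Y := Z.filter (fun z => ∀ q ∈ Q, ¬ r q z) with hY
    rcases Y.eq_empty_or_nonempty with hYe | ⟨z0, hz0⟩
    · refine ⟨Q, hQU, by omega, ?_⟩
      rw [← hY, hYe]
      simp only [Finset.card_empty, Nat.cast_zero]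
      have : (0:ℝ) ≤ 1 - p := by linarith
      positivity
    · -- double counting
      have hdc : ∑ q ∈ U, ((Y.filter (fun z => r q z)).card : ℝ)
          = ∑ z ∈ Y, ((U.filter (fun q => r q z)).card : ℝ) := by
        have := Finset.sum_card_bipartiteAbove_eq_sum_card_bipartiteBelow (s := U) (t := Y) r
        unfold Finset.bipartiteAbove Finset.bipartiteBelow at this
        exact_mod_cast this
      have hlow : p * N * Y.card ≤ ∑ z ∈ Y, ((U.filter (fun q => r q z)).card : ℝ) := by
        have := Finset.card_nsmul_le_sum Y (fun z => ((U.filter (fun q => r q z)).card : ℝ))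
          (p * N) (fun z hz => hZ z (Finset.mem_filter.1 hz).1)
        rw [nsmul_eq_mul] at this
        linarith
      have hex : ∃ q ∈ U, p * Y.card ≤ ((Y.filter (fun z => r q z)).card : ℝ) := by
        by_contra hcon
        push Not at hcon
        have hUne : U.Nonempty := by
          by_contra hUe
          rw [Finset.not_nonempty_iff_eq_empty] at hUe
          have := hZ z0 (Finset.mem_filter.1 hz0).1
          rw [hUe] at this
          simp only [Finset.filter_empty, Finset.card_empty, Nat.cast_zero] at this
          have : 0 < p * N := by positivity
          linarith
        have h1 := Finset.sum_lt_sum_of_nonempty hUne hcon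
        rw [hdc, Finset.sum_const, nsmul_eq_mul] at h1
        have : (U.card : ℝ) * (p * Y.card) ≤ N * (p * Y.card) := by
          apply mul_le_mul_of_nonneg_right hU; positivity
        nlinarith
      obtain ⟨q, hqU, hq⟩ := hex
      refine ⟨insert q Q, Finset.insert_subset hqU hQU, ?_, ?_⟩
      · have := Finset.card_insert_le q Q
        omega
      · have hsplit : (Z.filter (fun z => ∀ q' ∈ insert q Q, ¬ r q' z))
            = Y.filter (fun z => ¬ r q z) := by
          ext z
          simp only [hY, Finset.mem_filter, Finset.mem_insert, forall_eq_or_imp]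
          tauto
        rw [hsplit]
        have hc : ((Y.filter (fun z => r q z)).card : ℝ) + ((Y.filter (fun z => ¬ r q z)).card : ℝ)
            = Y.card := by
          exact_mod_cast Finset.card_filter_add_card_filter_not (s := Y) (fun z => r q z)
        have hp0 : (0:ℝ) ≤ 1 - p := by linarith
        calc ((Y.filter (fun z => ¬ r q z)).card : ℝ) ≤ Y.card * (1 - p) := by linarith
          _ ≤ (Z.card * (1 - p) ^ k) * (1 - p) := mul_le_mul_of_nonneg_right hQ hp0
          _ = _ := by ring

/-- existence of the sets `Q_v` -/
lemma exists_Q {n : ℕ} (G : ColoredGraph n) (K : Set (Fin n)) (ε : ℝ) (L D : ℕ)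
    (hε : 0 < ε) (hε1 : ε ≤ 1) (hn : 0 < n)
    (hcod : ∀ x ∉ K, ∀ y ∉ K, ε * n ≤ ((G.nbhd x ∩ G.nbhd y).ncard : ℝ))
    (hD : (D : ℝ) ≤ ε * n / 10) (hLD : L ≤ D) (hL : 2 ≤ L)
    (hnum : (n : ℝ) * (1 - 9 / 10 * ε) ^ (L - 2) + L < 2 * (n : ℝ) ^ ((1 : ℝ) - ε))
    (v : Fin n) (hv : v ∉ K) (F : Set (Fin n)) (hF : F.ncard ≤ D) (S : Set (Fin n))
    (hS : S ⊆ G.nbhd v \ F) (hS2 : S.ncard ≤ 2) :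
    ∃ Q : Set (Fin n), S ⊆ Q ∧ Q ⊆ G.nbhd v \ F ∧ Q.ncard = L ∧
      ((Set.univ \ (K ∪ G.nbhdSet Q)).ncard : ℝ) < 2 * (n : ℝ) ^ ((1 : ℝ) - ε) := by
  classical
  have hnR : (0:ℝ) < n := by exact_mod_cast hn
  have hFR : (F.ncard : ℝ) ≤ D := by exact_mod_cast hF
  have key : ∀ z ∉ K, 9 / 10 * ε * n ≤ (((G.nbhd v ∩ G.nbhd z) \ F).ncard : ℝ) := by
    intro z hz
    have h1 := hcod v hv z hz
    have h2 : (G.nbhd v ∩ G.nbhd z).ncard ≤ ((G.nbhd v ∩ G.nbhd z) \ F).ncard + F.ncard :=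
      Set.ncard_le_ncard_sdiff_add_ncard _ _
    have h3 : ((G.nbhd v ∩ G.nbhd z).ncard : ℝ) ≤ ((G.nbhd v ∩ G.nbhd z) \ F).ncard + F.ncard := by
      exact_mod_cast h2
    linarith
  set U : Finset (Fin n) := (G.nbhd v \ F).toFinset with hUdef
  set Z : Finset (Fin n) := (Kᶜ).toFinset with hZdef
  have hUcard : (U.card : ℝ) ≤ n := by
    have := Finset.card_le_univ U
    simp only [Fintype.card_fin] at this
    exact_mod_cast this
  have hZcard : (Z.card : ℝ) ≤ n := by
    have := Finset.card_le_univ Z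
    simp only [Fintype.card_fin] at this
    exact_mod_cast this
  obtain ⟨Q0, hQ0U, hQ0k, hQ0⟩ := greedy_cover (fun q z => G.Adj z q) U Z (9 / 10 * ε) n
    (by positivity) (by linarith) hnR hUcard (by
      intro z hz
      have hz' : z ∉ K := by simpa [hZdef] using hz
      refine (key z hz').trans ?_
      rw [Set.ncard_eq_toFinset_card']
      apply le_of_eq
      congr 2
      ext q
      simp only [hUdef, Set.mem_toFinset, Finset.mem_filter, Set.mem_sdiff, Set.mem_inter_iff]
      change (_ ∧ G.Adj z q) ∧ _ ↔ _
      tauto) (L - 2)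
  have hSU : S.toFinset ⊆ U := by
    intro q hq
    rw [hUdef, Set.mem_toFinset]
    exact hS (by simpa using hq)
  have hcard0 : (Q0 ∪ S.toFinset).card ≤ L := by
    have := Finset.card_union_le Q0 S.toFinset
    rw [← Set.ncard_eq_toFinset_card' S] at this
    omega
  have hUL : L ≤ U.card := by
    have h1 := key v hv
    rw [Set.inter_self, Set.ncard_eq_toFinset_card'] at h1
    have h2 : (L : ℝ) ≤ D := by exact_mod_cast hLD
    have h3 : (L : ℝ) ≤ U.card := by
      rw [hUdef]
      have : 0 < ε * n := by positivity
      linarith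
    exact_mod_cast h3
  obtain ⟨Q, hQ1, hQ2, hQ3⟩ := Finset.exists_subsuperset_card_eq
    (Finset.union_subset hQ0U hSU) hcard0 hUL
  refine ⟨Q, ?_, ?_, ?_, ?_⟩
  · intro q hq
    exact hQ1 (Finset.mem_union_right _ (by simpa using hq))
  · intro q hq
    have := hQ2 hq
    rwa [hUdef, Set.mem_toFinset] at this
  · rw [Set.ncard_coe_finset, hQ3]
  · have hsub : (Set.univ \ (K ∪ G.nbhdSet (Q : Set (Fin n)))) ⊆
        ((Z.filter (fun z => ∀ q ∈ Q0, ¬ G.Adj z q) ∪ Q : Finset (Fin n)) : Set (Fin n)) := by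
      intro z hz
      simp only [Set.mem_sdiff, Set.mem_univ, true_and, Set.mem_union, not_or] at hz
      obtain ⟨hzK, hzN⟩ := hz
      simp only [Finset.coe_union, Set.mem_union, Finset.mem_coe, Finset.mem_filter]
      by_cases hzQ : z ∈ Q
      · exact Or.inr hzQ
      · left
        refine ⟨by simpa [hZdef] using hzK, ?_⟩
        intro q hq hadj
        apply hzN
        refine ⟨?_, by simpa using hzQ⟩
        simp only [Set.mem_iUnion]
        exact ⟨q, hQ1 (Finset.mem_union_left _ hq), adj_symm hadj⟩
    have h1 := Set.ncard_le_ncard hsub (Set.toFinite _)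
    rw [Set.ncard_coe_finset] at h1
    have h2 := h1.trans (Finset.card_union_le _ _)
    rw [hQ3] at h2
    have h3 : ((Set.univ \ (K ∪ G.nbhdSet (Q : Set (Fin n)))).ncard : ℝ) ≤
        ((Z.filter (fun z => ∀ q ∈ Q0, ¬ G.Adj z q)).card : ℝ) + L := by exact_mod_cast h2
    have h4 : (Z.card : ℝ) * (1 - 9 / 10 * ε) ^ (L - 2) ≤ n * (1 - 9 / 10 * ε) ^ (L - 2) := by
      apply mul_le_mul_of_nonneg_right hZcard
      apply pow_nonneg; linarith
    have hQ0' : ((Z.filter (fun z => ∀ q ∈ Q0, ¬ G.Adj z q)).card : ℝ) ≤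
        (Z.card : ℝ) * (1 - 9 / 10 * ε) ^ (L - 2) := by
      convert hQ0
    linarith

/-! ### Collections indexed by arbitrary types -/

/-- add one pair to a collection -/
def optExt {ι α : Type*} (f : ι ⊕ ι → α) (a w : α) : Option ι ⊕ Option ι → α
  | Sum.inl none => a
  | Sum.inr none => w
  | Sum.inl (some i) => f (Sum.inl i)
  | Sum.inr (some i) => f (Sum.inr i)

lemma optExt_range {ι α : Type*} (f : ι ⊕ ι → α) (a w : α) :
    Set.range (optExt f a w) = Set.range f ∪ {a, w} := by
  ext z
  constructor
  · rintro ⟨(_ | i) | (_ | i), rfl⟩ <;> simp [optExt]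
  · rintro (⟨i | i, rfl⟩ | rfl | rfl)
    · exact ⟨Sum.inl (some i), rfl⟩
    · exact ⟨Sum.inr (some i), rfl⟩
    · exact ⟨Sum.inl none, rfl⟩
    · exact ⟨Sum.inr none, rfl⟩

lemma optExt_inj {ι α : Type*} (f : ι ⊕ ι → α) (a w : α) (hf : Function.Injective f)
    (ha : a ∉ Set.range f) (hw : w ∉ Set.range f) (haw : a ≠ w) :
    Function.Injective (optExt f a w) := by
  have ha' : ∀ i, f i ≠ a := fun i h => ha ⟨i, h⟩
  have hw' : ∀ i, f i ≠ w := fun i h => hw ⟨i, h⟩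
  rintro ((_ | i) | (_ | i)) ((_ | j) | (_ | j)) h <;>
    simp_all [optExt, hf.eq_iff, eq_comm]

lemma choose_pairs {α : Type*} [Finite α] (P : α → α → Prop) (k : ℕ)
    (h : ∀ F : Set α, F.ncard ≤ 2 * k → ∃ a w, P a w ∧ a ≠ w ∧ a ∉ F ∧ w ∉ F) :
    ∀ j ≤ k, ∃ (ι : Type) (_ : Fintype ι) (f : ι ⊕ ι → α), Fintype.card ι = j ∧
      Function.Injective f ∧ ∀ i, P (f (Sum.inl i)) (f (Sum.inr i)) := by
  intro j
  induction j with
  | zero =>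
    intro _
    exact ⟨Empty, inferInstance, fun x => by rcases x with x | x <;> exact x.elim, by simp,
      (by rintro (x | x) <;> exact x.elim), fun i => i.elim⟩
  | succ j ih =>
    intro hj
    obtain ⟨ι, _, f, hc, hinj, hP⟩ := ih (by omega)
    have hr : (Set.range f).ncard ≤ 2 * k := by
      rw [← Set.image_univ]
      refine (Set.ncard_image_le (Set.toFinite _)).trans ?_
      rw [Set.ncard_univ, Nat.card_eq_fintype_card, Fintype.card_sum]
      omega
    obtain ⟨a, w, hp, haw, ha, hw⟩ := h _ hr
    refine ⟨Option ι, inferInstance, optExt f a w, by simp [hc], optExt_inj f a w hinj ha hw haw, ?_⟩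
    rintro (_ | i)
    · exact hp
    · exact hP i

/-- `IsK3Coll` over an arbitrary index type -/
def K3Gen {n : ℕ} (G : ColoredGraph n) (ε : ℝ) (K2 : Set (Fin n)) (ι : Type)
    (f : ι ⊕ ι → Fin n) (Q : ι ⊕ ι → Set (Fin n)) : Prop :=
  Function.Injective f ∧ (∀ v, f v ∉ K1 G ε ∪ K2) ∧
    (∀ i : ι, G.Adj (f (Sum.inl i)) (f (Sum.inr i))) ∧
    (∀ v, Q v ⊆ G.nbhd (f v) \ Set.range f) ∧
    (∀ v, (Q v).ncard = ⌈Real.logb 2 n⌉₊) ∧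
    (∀ v, ((Set.univ \ (K1 G ε ∪ K2 ∪ G.nbhdSet (Q v))).ncard : ℝ) <
      2 * (n : ℝ) ^ ((1 : ℝ) - ε)) ∧
    ∀ i : ι,
      ε * n <
        ((Iset2 G (f (Sum.inl i)) (f (Sum.inr i)) (Q (Sum.inl i)) (Q (Sum.inr i))).ncard : ℝ)

lemma inj_le {n l : ℕ} (f : Fin l ⊕ Fin l → Fin n) (hf : Function.Injective f) : l ≤ n := by
  have := Fintype.card_le_of_injective f hf
  simp only [Fintype.card_sum, Fintype.card_fin] at this
  omega

lemma K3Gen.le {n : ℕ} {G : ColoredGraph n} {ε : ℝ} {K2 : Set (Fin n)} {ι : Type} [Fintype ι]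
    {f : ι ⊕ ι → Fin n} {Q : ι ⊕ ι → Set (Fin n)} (h : K3Gen G ε K2 ι f Q) :
    Fintype.card ι ≤ kappa3 G ε K2 := by
  unfold kappa3
  apply le_csSup
  · refine ⟨n, ?_⟩
    rintro l ⟨f, Q, h⟩
    exact inj_le f h.1
  · let e := (Fintype.equivFin ι).symm
    obtain ⟨h1, h2, h3, h4, h5, h6, h7⟩ := h
    refine ⟨f ∘ Sum.map e e, Q ∘ Sum.map e e, ?_, ?_, ?_, ?_, ?_, ?_, ?_⟩
    · exact h1.comp (Sum.map_injective.2 ⟨e.injective, e.injective⟩)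
    · exact fun v => h2 _
    · exact fun i => h3 (e i)
    · intro v z hz
      have := h4 _ hz
      exact ⟨this.1, fun hr => this.2 (Set.range_comp_subset_range _ _ hr)⟩
    · exact fun v => h5 _
    · exact fun v => h6 _
    · exact fun i => h7 (e i)

lemma K2_le {n : ℕ} {G : ColoredGraph n} {ε : ℝ} {ι : Type} [Fintype ι]
    {f : ι ⊕ ι → Fin n} (h1 : Function.Injective f) (h2 : ∀ v, f v ∉ K1 G ε)
    (h3 : ∀ i : ι, ((G.nbhd (f (Sum.inl i)) ∩ G.nbhd (f (Sum.inr i))).ncard : ℝ) < ε * n) :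
    Fintype.card ι ≤ kappa2 G ε := by
  unfold kappa2
  apply le_csSup
  · refine ⟨n, ?_⟩
    rintro l ⟨f, h⟩
    exact inj_le f h.1
  · let e := (Fintype.equivFin ι).symm
    refine ⟨f ∘ Sum.map e e, ?_, ?_, ?_⟩
    · exact h1.comp (Sum.map_injective.2 ⟨e.injective, e.injective⟩)
    · exact fun v => h2 _
    · exact fun i => h3 (e i)

lemma codegree {n : ℕ} {G : ColoredGraph n} {ε : ℝ} {K2 : Set (Fin n)} (h : IsMaxK2 G ε K2) :
    ∀ x ∉ K1 G ε ∪ K2, ∀ y ∉ K1 G ε ∪ K2,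
      ε * n ≤ ((G.nbhd x ∩ G.nbhd y).ncard : ℝ) := by
  obtain ⟨f, ⟨hinj, hK1, hc⟩, hr⟩ := h
  intro x hx y hy
  simp only [Set.mem_union, not_or] at hx hy
  by_contra hcon
  push Not at hcon
  by_cases hxy : x = y
  · subst hxy
    rw [Set.inter_self] at hcon
    exact hx.1 hcon
  have hle := K2_le (G := G) (ε := ε) (f := optExt f x y)
    (optExt_inj f x y hinj (hr ▸ hx.2) (hr ▸ hy.2) hxy)
    (by
      rintro ((_ | i) | (_ | i))
      · exact hx.1
      · exact hK1 _
      · exact hy.1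
      · exact hK1 _)
    (by
      rintro (_ | i)
      · exact hcon
      · exact hc i)
  simp only [Fintype.card_option, Fintype.card_fin] at hle
  omega

/-! ### The working context -/

/-- all standing assumptions -/
structure Ctx {n : ℕ} (G : ColoredGraph n) (ε : ℝ) (K2 : Set (Fin n)) (L s D : ℕ) : Prop where
  hG : G.OBTF
  hε : 0 < ε
  hε1 : ε < 1 / 100
  hn : 0 < n
  hLdef : ⌈Real.logb 2 n⌉₊ = L
  hDdef : D = 100 * (s + 2) * (L + 2)
  hL : 2 ≤ L
  hD : (D : ℝ) ≤ ε * n / 10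
  hnum : (n : ℝ) * (1 - 9 / 10 * ε) ^ (L - 2) + L < 2 * (n : ℝ) ^ ((1 : ℝ) - ε)
  hnum4 : 4 * (n : ℝ) ^ ((1 : ℝ) - ε) ≤ ε * n
  hcod : ∀ x ∉ K1 G ε ∪ K2, ∀ y ∉ K1 G ε ∪ K2, ε * n ≤ ((G.nbhd x ∩ G.nbhd y).ncard : ℝ)
  hk3 : kappa3 G ε K2 < s

section
variable {n : ℕ} {G : ColoredGraph n} {ε : ℝ} {K2 : Set (Fin n)} {L s D : ℕ}

lemma Ctx.exQ (c : Ctx G ε K2 L s D) (v : Fin n) (hv : v ∉ K1 G ε ∪ K2) (F : Set (Fin n))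
    (hF : F.ncard ≤ D) (S : Set (Fin n))
    (hS : S ⊆ G.nbhd v \ F) (hS2 : S.ncard ≤ 2) :
    ∃ Q : Set (Fin n), S ⊆ Q ∧ Q ⊆ G.nbhd v \ F ∧ Q.ncard = L ∧
      ((Set.univ \ (K1 G ε ∪ K2 ∪ G.nbhdSet Q)).ncard : ℝ) < 2 * (n : ℝ) ^ ((1 : ℝ) - ε) := by
  have h := c.hε1
  refine exists_Q G (K1 G ε ∪ K2) ε L D c.hε (by linarith) c.hn c.hcod c.hD ?_ c.hL c.hnum v hv F
    hF S hS hS2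
  rw [c.hDdef]
  nlinarith

lemma Ctx.pos (c : Ctx G ε K2 L s D) : 0 < ε * n := by
  have h1 := c.hε
  have h2 : (0:ℝ) < n := by exact_mod_cast c.hn
  positivity

lemma Ctx.common (c : Ctx G ε K2 L s D) {x y : Fin n} (hx : x ∉ K1 G ε ∪ K2)
    (hy : y ∉ K1 G ε ∪ K2) (F : Set (Fin n)) (hF : F.ncard ≤ D) :
    ∃ z, G.Adj x z ∧ G.Adj y z ∧ z ∉ F := by
  have h1 := c.hcod x hx y hy
  have h2 := c.hD
  have h3 := c.pos
  have h4 : F.ncard < (G.nbhd x ∩ G.nbhd y).ncard := by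
    have : (F.ncard : ℝ) ≤ D := by exact_mod_cast hF
    have : (F.ncard : ℝ) < (G.nbhd x ∩ G.nbhd y).ncard := by linarith
    exact_mod_cast this
  obtain ⟨z, hz, hzF⟩ := Set.exists_mem_notMem_of_ncard_lt_ncard h4
  exact ⟨z, hz.1, hz.2, hzF⟩

lemma odd5 {a b d e f : ℕ} : Odd (a + b + d + e + f) ↔
    (a : ZMod 2) + b + d + e + f = 1 := by
  rw [← ZMod.natCast_eq_one_iff_odd]
  push_cast
  rfl

/-- an odd 4-cycle makes the pair `a w` bad -/
lemma Ctx.bad4 (c : Ctx G ε K2 L s D) {x a w b b' : Fin n} {Qa Qw : Set (Fin n)}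
    (hx : x ∉ K1 G ε ∪ K2) (hb : b ∉ K1 G ε ∪ K2)
    (hxa : G.Adj x a) (haw : G.Adj a w) (hwb : G.Adj w b) (hbx : G.Adj b x)
    (hodd : cz G x a + cz G a w + cz G w b + cz G b x ≠ 0)
    (hxQ : x ∈ Qa) (hbQ : b ∈ Qw) (hbQ' : b' ∈ Qw) (hbb : G.Adj b b') (hwb' : G.Adj w b')
    (hba : b' ≠ a) (hbx' : b' ≠ x) :
    ε * n < ((Iset2 G a w Qa Qw).ncard : ℝ) := by
  have nab : ¬ G.Adj a b := by
    intro h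
    have h1 := tri c.hG hxa h (adj_symm hbx)
    have h2 := tri c.hG haw hwb h
    apply hodd
    rw [cz_symm G b x, ← h1, ← h2]
    generalize cz G x a = p
    generalize cz G a w = q
    generalize cz G w b = r
    revert p q r; decide
  have nxw : ¬ G.Adj x w := by
    intro h
    have h1 := tri c.hG hxa haw h
    have h2 := tri c.hG h hwb (adj_symm hbx)
    apply hodd
    rw [cz_symm G b x, ← h2, ← h1]
    generalize cz G x a = p
    generalize cz G a w = q
    generalize cz G w b = r
    revert p q r; decide
  have hab : a ≠ b := by
    rintro rfl
    apply hodd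
    rw [cz_symm G w a, cz_symm G x a]
    generalize cz G a x = p
    generalize cz G a w = q
    revert p q; decide
  have hxw : x ≠ w := by
    rintro rfl
    apply hodd
    rw [cz_symm G a x, cz_symm G b x]
    generalize cz G x a = p
    generalize cz G x b = q
    revert p q; decide
  have hsub : insert b (G.nbhd x ∩ G.nbhd b) ⊆ Iset2 G a w Qa Qw := by
    rintro z (rfl | ⟨hz1, hz2⟩)
    · right
      refine ⟨x, hxQ, b', hbQ', ?_, adj_symm hxa, adj_symm hbx, hbb, adj_symm hwb', adj_symm haw, ?_⟩
      · simp only [List.pairwise_cons, List.mem_cons, List.not_mem_nil, or_false, forall_eq_or_imp,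
          forall_eq]
        simp only [false_imp_iff, implies_true, List.Pairwise.nil, and_true]
        exact ⟨⟨(adj_ne hxa).symm, hab, hba.symm, adj_ne haw⟩,
          ⟨(adj_ne hbx).symm, hbx'.symm, hxw⟩, ⟨adj_ne hbb, (adj_ne hwb).symm⟩, (adj_ne hwb').symm⟩
      · rw [odd5]
        change cz G a x + cz G x z + cz G z b' + cz G b' w + cz G w a = 1
        have h1 := tri c.hG hwb hbb hwb'
        apply z2_ne
        intro h0
        apply hodd
        rw [← h0, cz_symm G b' w, ← h1, cz_symm G a x, cz_symm G x z, cz_symm G w a]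
        generalize cz G x a = p
        generalize cz G a w = q
        generalize cz G w z = r
        generalize cz G z x = t
        generalize cz G z b' = u
        revert p q r t u; decide
    · right
      change G.Adj x z at hz1
      change G.Adj b z at hz2
      refine ⟨x, hxQ, b, hbQ, ?_, adj_symm hxa, hz1, adj_symm hz2, adj_symm hwb, adj_symm haw, ?_⟩
      · simp only [List.pairwise_cons, List.mem_cons, List.not_mem_nil, or_false, forall_eq_or_imp,
          forall_eq]
        simp only [false_imp_iff, implies_true, List.Pairwise.nil, and_true]
        refine ⟨⟨(adj_ne hxa).symm, ?_, hab, adj_ne haw⟩,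
          ⟨(adj_ne hz1), (adj_ne hbx).symm, hxw⟩, ⟨(adj_ne hz2).symm, ?_⟩, (adj_ne hwb).symm⟩
        · rintro rfl; exact nab (adj_symm hz2)
        · rintro rfl; exact nxw hz1
      · rw [odd5]
        change cz G a x + cz G x z + cz G z b + cz G b w + cz G w a = 1
        have h1 := tri c.hG hbx hz1 hz2
        apply z2_ne
        intro h0
        apply hodd
        rw [← h0, cz_symm G z b, ← h1, cz_symm G a x, cz_symm G b w, cz_symm G w a]
        generalize cz G x a = p
        generalize cz G a w = q
        generalize cz G w b = r
        generalize cz G b x = t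
        generalize cz G x z = u
        revert p q r t u; decide
  have h1 := Set.ncard_le_ncard hsub (Set.toFinite _)
  have hnot : b ∉ G.nbhd x ∩ G.nbhd b := fun h => (adj_ne h.2) rfl
  rw [Set.ncard_insert_of_notMem hnot (Set.toFinite _)] at h1
  have h2 := c.hcod x hx b hb
  have h3 : ((G.nbhd x ∩ G.nbhd b).ncard : ℝ) + 1 ≤ (Iset2 G a w Qa Qw).ncard := by exact_mod_cast h1
  linarith
end

section
variable {n : ℕ} {G : ColoredGraph n} {ε : ℝ} {K2 : Set (Fin n)} {L s D : ℕ}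

lemma Ctx.D2 (c : Ctx G ε K2 L s D) : 400 * (s + 2) ≤ D := by
  have := c.hL
  rw [c.hDdef]
  nlinarith

lemma ncard_pair_le {α : Type*} (a b : α) : ({a, b} : Set α).ncard ≤ 2 := by
  have := Set.ncard_insert_le a {b}
  rw [Set.ncard_singleton] at this
  exact this

/-- a vertex outside `K1 ∪ K2` sees a balanced remainder consistently -/
lemma Ctx.step5 (c : Ctx G ε K2 L s D) (T : Set (Fin n)) (hKT : K1 G ε ∪ K2 ⊆ T)
    (hT : 10 * T.ncard ≤ D) (φ : Fin n → ZMod 2)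
    (hφ : ∀ x ∉ T, ∀ y ∉ T, G.Adj x y → cz G x y = φ x + φ y)
    {x a b : Fin n} (hx : x ∉ K1 G ε ∪ K2) (ha : a ∉ T) (hb : b ∉ T)
    (hxa : G.Adj x a) (hxb : G.Adj x b) : cz G x a + φ a = cz G x b + φ b := by
  by_contra hne
  have hD2 := c.D2
  have hbK : b ∉ K1 G ε ∪ K2 := fun h => hb (hKT h)
  obtain ⟨ι, _, f, hcard, hinj, hP⟩ := choose_pairs
    (fun a' w => (a' ∉ T ∧ w ∉ T) ∧ (G.Adj x a' ∧ G.Adj a' w ∧ G.Adj w b) ∧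
      cz G x a' + φ a' = cz G x a + φ a ∧ a' ≠ b ∧ w ≠ x) s (by
      intro F hF
      have hF1 : (F ∪ T ∪ {b}).ncard ≤ D := by
        have h1 := Set.ncard_union_le (F ∪ T) {b}
        have h2 := Set.ncard_union_le F T
        rw [Set.ncard_singleton] at h1
        omega
      have hF2 : (F ∪ T ∪ {x}).ncard ≤ D := by
        have h1 := Set.ncard_union_le (F ∪ T) {x}
        have h2 := Set.ncard_union_le F T
        rw [Set.ncard_singleton] at h1
        omega
      obtain ⟨a', h1, h2, h3⟩ := c.common hx (fun h => ha (hKT h)) _ hF1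
      simp only [Set.mem_union, Set.mem_singleton_iff, not_or] at h3
      obtain ⟨⟨h3, h4⟩, h5⟩ := h3
      obtain ⟨w, k1, k2, k3⟩ := c.common (fun h => h4 (hKT h)) hbK _ hF2
      simp only [Set.mem_union, Set.mem_singleton_iff, not_or] at k3
      obtain ⟨⟨k3, k4⟩, k5⟩ := k3
      refine ⟨a', w, ⟨⟨h4, k4⟩, ⟨h1, k1, adj_symm k2⟩, ?_, h5, k5⟩, adj_ne k1, h3, k3⟩
      have t1 := tri c.hG hxa h2 h1
      rw [hφ a ha a' h4 h2] at t1
      rw [← t1]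
      generalize cz G x a = p
      generalize φ a = q
      generalize φ a' = r
      revert p q r; decide) s le_rfl
  set R := Set.range f with hR
  have hRc : R.ncard ≤ 2 * s := by
    rw [hR, ← Set.image_univ]
    refine (Set.ncard_image_le (Set.toFinite _)).trans ?_
    rw [Set.ncard_univ, Nat.card_eq_fintype_card, Fintype.card_sum]
    omega
  have hRD : R.ncard ≤ D := by omega
  have hRx : (R ∪ {x}).ncard ≤ D := by
    have h1 := Set.ncard_union_le R {x}
    rw [Set.ncard_singleton] at h1
    omega
  have hxR : x ∉ R := by
    rintro ⟨i | i, hi⟩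
    · exact (adj_ne (hP i).2.1.1) hi.symm
    · exact (hP i).2.2.2.2 hi
  have hbR : b ∉ R := by
    rintro ⟨i | i, hi⟩
    · exact (hP i).2.2.2.1 hi
    · exact (adj_ne (hP i).2.1.2.2) hi
  have hQa : ∀ i : ι, ∃ Q : Set (Fin n), {x} ⊆ Q ∧ Q ⊆ G.nbhd (f (Sum.inl i)) \ R ∧ Q.ncard = L ∧
      ((Set.univ \ (K1 G ε ∪ K2 ∪ G.nbhdSet Q)).ncard : ℝ) < 2 * (n : ℝ) ^ ((1 : ℝ) - ε) := by
    intro i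
    apply c.exQ _ (fun h => (hP i).1.1 (hKT h)) R hRD
    · rintro z rfl
      exact ⟨adj_symm (hP i).2.1.1, hxR⟩
    · rw [Set.ncard_singleton]; omega
  have hQw : ∀ i : ι, ∃ b', (G.Adj b b' ∧ G.Adj (f (Sum.inr i)) b' ∧ b' ∉ R ∪ {x}) ∧
      ∃ Q : Set (Fin n), {b, b'} ⊆ Q ∧ Q ⊆ G.nbhd (f (Sum.inr i)) \ R ∧ Q.ncard = L ∧
      ((Set.univ \ (K1 G ε ∪ K2 ∪ G.nbhdSet Q)).ncard : ℝ) < 2 * (n : ℝ) ^ ((1 : ℝ) - ε) := by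
    intro i
    have hwK : f (Sum.inr i) ∉ K1 G ε ∪ K2 := fun h => (hP i).1.2 (hKT h)
    obtain ⟨b', h1, h2, h3⟩ := c.common hbK hwK _ hRx
    refine ⟨b', ⟨h1, h2, h3⟩, ?_⟩
    apply c.exQ _ hwK R hRD
    · rintro z (rfl | rfl)
      · exact ⟨(hP i).2.1.2.2, hbR⟩
      · exact ⟨h2, fun h => h3 (Or.inl h)⟩
    · exact ncard_pair_le _ _
  choose Qa hQa1 hQa2 hQa3 hQa4 using hQa
  choose b' hb' Qw hQw1 hQw2 hQw3 hQw4 using hQw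
  have hgen : K3Gen G ε K2 ι f (Sum.elim Qa Qw) := by
    refine ⟨hinj, ?_, fun i => (hP i).2.1.2.1, ?_, ?_, ?_, ?_⟩
    · rintro (i | i)
      · exact fun h => (hP i).1.1 (hKT h)
      · exact fun h => (hP i).1.2 (hKT h)
    · rintro (i | i)
      · exact hQa2 i
      · exact hQw2 i
    · rw [c.hLdef]
      rintro (i | i)
      · exact hQa3 i
      · exact hQw3 i
    · rintro (i | i)
      · exact hQa4 i
      · exact hQw4 i
    · intro i
      obtain ⟨⟨p1, p2⟩, ⟨p3, p4, p5⟩, p6, p7, p8⟩ := hP i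
      obtain ⟨r1, r2, r3⟩ := hb' i
      refine c.bad4 (x := x) (b := b) (b' := b' i) hx hbK p3 p4 p5 (adj_symm hxb) ?_
        (hQa1 i rfl) (hQw1 i (Or.inl rfl)) (hQw1 i (Or.inr rfl)) r1 r2 ?_ ?_
      · intro h0
        apply hne
        rw [hφ _ p1 _ p2 p4, hφ _ p2 _ hb p5, cz_symm G b x] at h0
        rw [← p6]
        revert h0
        generalize cz G x (f (Sum.inl i)) = p
        generalize cz G x b = q
        generalize φ (f (Sum.inl i)) = r
        generalize φ (f (Sum.inr i)) = t
        generalize φ b = u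
        revert p q r t u; decide
      · intro h
        exact r3 (Or.inl (h ▸ ⟨_, rfl⟩))
      · intro h
        exact r3 (Or.inr h)
  have := hgen.le
  have := c.hk3
  omega

/-- extending the maximum collection by one pair is impossible -/
lemma ext4 {f : Fin (kappa3 G ε K2) ⊕ Fin (kappa3 G ε K2) → Fin n}
    {Q : Fin (kappa3 G ε K2) ⊕ Fin (kappa3 G ε K2) → Set (Fin n)}
    (h : IsK3Coll G ε K2 (kappa3 G ε K2) f Q) {a w : Fin n} {Qa Qw : Set (Fin n)}
    (ha : a ∉ K1 G ε ∪ K2) (hw : w ∉ K1 G ε ∪ K2) (haf : a ∉ Set.range f) (hwf : w ∉ Set.range f)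
    (haQ : ∀ v, a ∉ Q v) (hwQ : ∀ v, w ∉ Q v) (haw : G.Adj a w)
    (hQa : Qa ⊆ G.nbhd a \ (Set.range f ∪ {a, w})) (hQw : Qw ⊆ G.nbhd w \ (Set.range f ∪ {a, w}))
    (hQa1 : Qa.ncard = ⌈Real.logb 2 n⌉₊) (hQw1 : Qw.ncard = ⌈Real.logb 2 n⌉₊)
    (hQa2 : ((Set.univ \ (K1 G ε ∪ K2 ∪ G.nbhdSet Qa)).ncard : ℝ) < 2 * (n : ℝ) ^ ((1 : ℝ) - ε))
    (hQw2 : ((Set.univ \ (K1 G ε ∪ K2 ∪ G.nbhdSet Qw)).ncard : ℝ) < 2 * (n : ℝ) ^ ((1 : ℝ) - ε)) :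
    ((Iset2 G a w Qa Qw).ncard : ℝ) ≤ ε * n := by
  by_contra hcon
  push Not at hcon
  obtain ⟨h1, h2, h3, h4, h5, h6, h7⟩ := h
  have hold : ∀ v, Q v ⊆ G.nbhd (f v) \ (Set.range f ∪ {a, w}) := by
    intro v z hz
    refine ⟨(h4 v hz).1, ?_⟩
    rintro (hr | rfl | rfl)
    · exact (h4 v hz).2 hr
    · exact haQ v hz
    · exact hwQ v hz
  have hgen : K3Gen G ε K2 (Option (Fin (kappa3 G ε K2))) (optExt f a w) (optExt Q Qa Qw) := by
    refine ⟨optExt_inj f a w h1 haf hwf (adj_ne haw), ?_, ?_, ?_, ?_, ?_, ?_⟩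
    · rintro ((_ | i) | (_ | i))
      · exact ha
      · exact h2 _
      · exact hw
      · exact h2 _
    · rintro (_ | i)
      · exact haw
      · exact h3 _
    · rw [optExt_range]
      rintro ((_ | i) | (_ | i))
      · exact hQa
      · exact hold _
      · exact hQw
      · exact hold _
    · rintro ((_ | i) | (_ | i))
      · exact hQa1
      · exact h5 _
      · exact hQw1
      · exact h5 _
    · rintro ((_ | i) | (_ | i))
      · exact hQa2
      · exact h6 _
      · exact hQw2
      · exact h6 _
    · rintro (_ | i)
      · exact hcon
      · exact h7 _
  have := hgen.le
  simp only [Fintype.card_option, Fintype.card_fin] at this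
  omega

/-- the graph outside `T` is balanced -/
lemma Ctx.step4 (c : Ctx G ε K2 L s D) {f : Fin (kappa3 G ε K2) ⊕ Fin (kappa3 G ε K2) → Fin n}
    {Q : Fin (kappa3 G ε K2) ⊕ Fin (kappa3 G ε K2) → Set (Fin n)}
    (h : IsK3Coll G ε K2 (kappa3 G ε K2) f Q) (T : Set (Fin n))
    (hTdef : T = K1 G ε ∪ K2 ∪ Set.range f ∪ ⋃ v, Q v) (hT : 10 * T.ncard ≤ D) :
    ∃ φ : Fin n → ZMod 2, ∀ x ∉ T, ∀ y ∉ T, G.Adj x y → cz G x y = φ x + φ y := by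
  have hD2 := c.D2
  have hKT : K1 G ε ∪ K2 ⊆ T := by
    rw [hTdef]; exact fun z hz => Or.inl (Or.inl hz)
  have hfT : Set.range f ⊆ T := by
    rw [hTdef]; exact fun z hz => Or.inl (Or.inr hz)
  have hQT : ∀ v, Q v ⊆ T := by
    intro v
    rw [hTdef]; exact fun z hz => Or.inr (Set.mem_iUnion.2 ⟨v, hz⟩)
  have hT2 : ∀ a w : Fin n, (T ∪ {a, w}).ncard ≤ D := by
    intro a w
    have h1 := Set.ncard_union_le T {a, w}
    have h2 := ncard_pair_le a w
    omega
  have hnK : ∀ {x}, x ∉ T → x ∉ K1 G ε ∪ K2 := fun hx hk => hx (hKT hk)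
  -- a combined statement
  have hI : ∀ a ∉ T, ∀ w ∉ T, G.Adj a w → ∀ Sa Sw : Set (Fin n),
      Sa ⊆ G.nbhd a \ (T ∪ {a, w}) → Sw ⊆ G.nbhd w \ (T ∪ {a, w}) → Sa.ncard ≤ 2 → Sw.ncard ≤ 2 →
      ∃ Qa Qw : Set (Fin n), Sa ⊆ Qa ∧ Sw ⊆ Qw ∧
        Qa ⊆ G.nbhd a \ (T ∪ {a, w}) ∧ Qw ⊆ G.nbhd w \ (T ∪ {a, w}) ∧
        ((Set.univ \ (K1 G ε ∪ K2 ∪ G.nbhdSet Qa)).ncard : ℝ) < 2 * (n : ℝ) ^ ((1 : ℝ) - ε) ∧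
        ((Set.univ \ (K1 G ε ∪ K2 ∪ G.nbhdSet Qw)).ncard : ℝ) < 2 * (n : ℝ) ^ ((1 : ℝ) - ε) ∧
        ((Iset2 G a w Qa Qw).ncard : ℝ) ≤ ε * n := by
    intro a ha w hw haw Sa Sw hSa hSw hSa2 hSw2
    obtain ⟨Qa, a1, a2, a3, a4⟩ := c.exQ a (hnK ha) _ (hT2 a w) Sa hSa hSa2
    obtain ⟨Qw, w1, w2, w3, w4⟩ := c.exQ w (hnK hw) _ (hT2 a w) Sw hSw hSw2
    refine ⟨Qa, Qw, a1, w1, a2, w2, a4, w4, ?_⟩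
    have hmono : Set.range f ∪ {a, w} ⊆ T ∪ {a, w} := Set.union_subset_union_left _ hfT
    exact ext4 h (hnK ha) (hnK hw) (fun h => ha (hfT h)) (fun h => hw (hfT h))
      (fun v h => ha (hQT v h)) (fun v h => hw (hQT v h)) haw
      (a2.trans (Set.sdiff_subset_sdiff_right hmono)) (w2.trans (Set.sdiff_subset_sdiff_right hmono))
      (a3.trans c.hLdef.symm) (w3.trans c.hLdef.symm) a4 w4
  -- 4-cycles are balanced
  have H4 : ∀ x ∉ T, ∀ a ∉ T, ∀ w ∉ T, ∀ b ∉ T, G.Adj x a → G.Adj a w → G.Adj w b → G.Adj b x →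
      cz G x a + cz G a w + cz G w b + cz G b x = 0 := by
    intro x hx a ha w hw b hb hxa haw hwb hbx
    by_contra hodd
    have hF : (T ∪ {a, w} ∪ {x}).ncard ≤ D := by
      have h1 := Set.ncard_union_le T {a, w}
      have h2 := ncard_pair_le a w
      have h3 := Set.ncard_union_le (T ∪ {a, w}) {x}
      rw [Set.ncard_singleton] at h3
      omega
    obtain ⟨b', hb1, hb2, hb3⟩ := c.common (hnK hb) (hnK hw) _ hF
    have hab : a ≠ b := by
      rintro rfl
      apply hodd
      rw [cz_symm G w a, cz_symm G x a]
      generalize cz G a x = p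
      generalize cz G a w = q
      revert p q; decide
    have hxw : x ≠ w := by
      rintro rfl
      apply hodd
      rw [cz_symm G a x, cz_symm G b x]
      generalize cz G x a = p
      generalize cz G x b = q
      revert p q; decide
    obtain ⟨Qa, Qw, q1, q2, q3, q4, q5, q6, q7⟩ := hI a ha w hw haw {x} {b, b'} (by
        rintro z rfl
        refine ⟨adj_symm hxa, ?_⟩
        rintro (h | rfl | h)
        · exact hx h
        · exact adj_ne hxa rfl
        · exact hxw h) (by
        rintro z (rfl | rfl)
        · refine ⟨hwb, ?_⟩
          rintro (h | h | h)
          · exact hb h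
          · exact hab h.symm
          · exact (adj_ne hwb) h.symm
        · exact ⟨hb2, fun h => hb3 (Or.inl h)⟩) (by rw [Set.ncard_singleton]; omega)
        (ncard_pair_le _ _)
    have := c.bad4 (hnK hx) (hnK hb) hxa haw hwb hbx hodd (q1 rfl) (q2 (Or.inl rfl))
      (q2 (Or.inr rfl)) hb1 hb2 (fun h => hb3 (Or.inl (Or.inr (Or.inl h))))
      (fun h => hb3 (Or.inr h))
    linarith
  -- common neighbours outside T
  have hTD : T.ncard ≤ D := by omega
  have hcom : ∀ x z : Fin n, ∃ q, x ∉ T → z ∉ T → (G.Adj x q ∧ G.Adj z q ∧ q ∉ T) := by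
    intro x z
    by_cases hxz : x ∉ T ∧ z ∉ T
    · obtain ⟨q, hq⟩ := c.common (hnK hxz.1) (hnK hxz.2) T hTD
      exact ⟨q, fun _ _ => hq⟩
    · exact ⟨x, fun h1 h2 => absurd ⟨h1, h2⟩ hxz⟩
  choose m hm using hcom
  let τ : Fin n → Fin n → ZMod 2 := fun x z => cz G x (m x z) + cz G (m x z) z
  have hτ : ∀ x ∉ T, ∀ z ∉ T, ∀ q ∉ T, G.Adj x q → G.Adj q z → τ x z = cz G x q + cz G q z := by
    intro x hx z hz q hq hxq hqz
    obtain ⟨m1, m2, m3⟩ := hm x z hx hz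
    have := H4 x hx q hq z hz (m x z) m3 hxq hqz m2 (adj_symm m1)
    change cz G x (m x z) + cz G (m x z) z = _
    rw [cz_symm G z, cz_symm G _ x] at this
    revert this
    generalize cz G x (m x z) = p
    generalize cz G (m x z) z = r
    generalize cz G x q = t
    generalize cz G q z = u
    revert p r t u; decide
  have hτs : ∀ x ∉ T, ∀ z ∉ T, τ x z = τ z x := by
    intro x hx z hz
    obtain ⟨m1, m2, m3⟩ := hm x z hx hz
    rw [hτ z hz x hx (m x z) m3 m2 (adj_symm m1), cz_symm G z, cz_symm G _ x, add_comm]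
  -- inconsistent sets for edges
  have hJ : ∀ x ∉ T, ∀ y ∉ T, G.Adj x y →
      (({z | z ∉ T ∧ z ≠ x ∧ z ≠ y ∧ τ x z + τ z y ≠ cz G x y} : Set (Fin n)).ncard : ℝ)
        ≤ 2 * (ε * n) := by
    intro x hx y hy hxy
    obtain ⟨Qx, Qy, -, -, q3, q4, q5, q6, q7⟩ := hI x hx y hy hxy ∅ ∅ (by simp) (by simp) (by simp)
      (by simp)
    have hsub : ({z | z ∉ T ∧ z ≠ x ∧ z ≠ y ∧ τ x z + τ z y ≠ cz G x y} : Set (Fin n)) ⊆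
        Iset2 G x y Qx Qy ∪ (Set.univ \ (K1 G ε ∪ K2 ∪ G.nbhdSet Qx)) ∪
          (Set.univ \ (K1 G ε ∪ K2 ∪ G.nbhdSet Qy)) := by
      rintro z ⟨hzT, hzx, hzy, hz⟩
      by_cases hx1 : z ∈ G.nbhdSet Qx
      swap
      · exact Or.inl (Or.inr ⟨trivial, fun h => h.elim (hnK hzT) hx1⟩)
      by_cases hy1 : z ∈ G.nbhdSet Qy
      swap
      · exact Or.inr ⟨trivial, fun h => h.elim (hnK hzT) hy1⟩
      left; left
      obtain ⟨hx1, -⟩ := hx1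
      obtain ⟨hy1, -⟩ := hy1
      simp only [Set.mem_iUnion] at hx1 hy1
      obtain ⟨x1, hx1Q, hx1z⟩ := hx1
      obtain ⟨y1, hy1Q, hy1z⟩ := hy1
      change G.Adj x1 z at hx1z
      change G.Adj y1 z at hy1z
      obtain ⟨hxx1, hx1T⟩ := q3 hx1Q
      obtain ⟨hyy1, hy1T⟩ := q4 hy1Q
      change G.Adj x x1 at hxx1
      change G.Adj y y1 at hyy1
      simp only [Set.mem_union, Set.mem_insert_iff, Set.mem_singleton_iff, not_or] at hx1T hy1T
      have e1 := hτ x hx z hzT x1 hx1T.1 hxx1 hx1z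
      have e2 := hτ z hzT y hy y1 hy1T.1 (adj_symm hy1z) (adj_symm hyy1)
      right
      refine ⟨x1, hx1Q, y1, hy1Q, ?_, hxx1, hx1z, adj_symm hy1z, adj_symm hyy1, adj_symm hxy, ?_⟩
      · simp only [List.pairwise_cons, List.mem_cons, List.not_mem_nil, or_false, forall_eq_or_imp,
          forall_eq]
        simp only [false_imp_iff, implies_true, List.Pairwise.nil, and_true]
        refine ⟨⟨adj_ne hxx1, hzx.symm, fun h => hy1T.2.1 h.symm, adj_ne hxy⟩,
          ⟨adj_ne hx1z, ?_, hx1T.2.2⟩, ⟨(adj_ne hy1z).symm, hzy⟩, hy1T.2.2⟩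
        rintro rfl
        apply hz
        have t1 := tri c.hG hxx1 (adj_symm hyy1) hxy
        rw [e1, e2, ← t1, cz_symm G z x1]
        generalize cz G x x1 = p
        generalize cz G x1 z = q
        generalize cz G x1 y = r
        revert p q r; decide
      · rw [odd5]
        change cz G x x1 + cz G x1 z + cz G z y1 + cz G y1 y + cz G y x = 1
        rw [e1, e2] at hz
        apply z2_ne
        intro h0
        apply hz
        rw [cz_symm G y x] at h0
        revert h0
        generalize cz G x x1 = p
        generalize cz G x1 z = q
        generalize cz G z y1 = r
        generalize cz G y1 y = t
        generalize cz G x y = u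
        revert p q r t u; decide
    have h1 := Set.ncard_le_ncard hsub (Set.toFinite _)
    have h2 := Set.ncard_union_le (Iset2 G x y Qx Qy ∪ (Set.univ \ (K1 G ε ∪ K2 ∪ G.nbhdSet Qx)))
          (Set.univ \ (K1 G ε ∪ K2 ∪ G.nbhdSet Qy))
    have h3 := Set.ncard_union_le (Iset2 G x y Qx Qy) (Set.univ \ (K1 G ε ∪ K2 ∪ G.nbhdSet Qx))
    have h4 := h1.trans (h2.trans (Nat.add_le_add_right h3 _))
    have h5 := (Nat.cast_le (α := ℝ)).2 h4
    push_cast at h5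
    have := c.hnum4
    linarith
  -- root
  by_cases hW : ∃ x0, x0 ∉ T
  swap
  · push Not at hW
    exact ⟨0, fun x hx => absurd (hW x) hx⟩
  obtain ⟨x0, hx0⟩ := hW
  refine ⟨fun x => τ x0 x, ?_⟩
  intro x hx y hy hxy
  obtain ⟨a, ha⟩ : ∃ a, a = m x0 x := ⟨_, rfl⟩
  obtain ⟨b, hb⟩ : ∃ b, b = m x0 y := ⟨_, rfl⟩
  obtain ⟨a1, a2, a3⟩ := hm x0 x hx0 hx
  obtain ⟨b1, b2, b3⟩ := hm x0 y hx0 hy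
  rw [← ha] at a1 a2 a3
  rw [← hb] at b1 b2 b3
  let J : Fin n → Fin n → Set (Fin n) := fun x y =>
    {z | z ∉ T ∧ z ≠ x ∧ z ≠ y ∧ τ x z + τ z y ≠ cz G x y}
  let B : Set (Fin n) := T ∪ {x0, x} ∪ {y, a} ∪ {b, b} ∪ J x0 a ∪ J a x ∪ J x0 b ∪ J b y ∪ J x y
  have hB : B.ncard < (Set.univ : Set (Fin n)).ncard := by
    have u1 := Set.ncard_union_le (T ∪ {x0, x} ∪ {y, a} ∪ {b, b} ∪ J x0 a ∪ J a x ∪ J x0 b ∪ J b y)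
      (J x y)
    have u2 := Set.ncard_union_le (T ∪ {x0, x} ∪ {y, a} ∪ {b, b} ∪ J x0 a ∪ J a x ∪ J x0 b)
      (J b y)
    have u3 := Set.ncard_union_le (T ∪ {x0, x} ∪ {y, a} ∪ {b, b} ∪ J x0 a ∪ J a x) (J x0 b)
    have u4 := Set.ncard_union_le (T ∪ {x0, x} ∪ {y, a} ∪ {b, b} ∪ J x0 a) (J a x)
    have u5 := Set.ncard_union_le (T ∪ {x0, x} ∪ {y, a} ∪ {b, b}) (J x0 a)
    have u6 := Set.ncard_union_le (T ∪ {x0, x} ∪ {y, a}) {b, b}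
    have u7 := Set.ncard_union_le (T ∪ {x0, x}) {y, a}
    have u8 := Set.ncard_union_le T {x0, x}
    have p1 := ncard_pair_le x0 x
    have p2 := ncard_pair_le y a
    have p3 := ncard_pair_le b b
    have u9 : B.ncard ≤ D + (J x0 a).ncard + (J a x).ncard + (J x0 b).ncard + (J b y).ncard +
        (J x y).ncard := by
      change (_ ∪ J x y).ncard ≤ _
      omega
    have u10 := (Nat.cast_le (α := ℝ)).2 u9
    push_cast at u10
    have j1 := hJ x0 hx0 a a3 a1
    have j2 := hJ a a3 x hx (adj_symm a2)
    have j3 := hJ x0 hx0 b b3 b1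
    have j4 := hJ b b3 y hy (adj_symm b2)
    have j5 := hJ x hx y hy hxy
    have hD := c.hD
    have hε1 := c.hε1
    have hn : (0:ℝ) < n := by exact_mod_cast c.hn
    have hεn : ε * n < 1 / 100 * n := mul_lt_mul_of_pos_right hε1 hn
    have hlt : (B.ncard : ℝ) < n := by
      change ((J x0 a).ncard : ℝ) ≤ _ at j1
      change ((J a x).ncard : ℝ) ≤ _ at j2
      change ((J x0 b).ncard : ℝ) ≤ _ at j3
      change ((J b y).ncard : ℝ) ≤ _ at j4
      change ((J x y).ncard : ℝ) ≤ _ at j5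
      linarith
    rw [Set.ncard_univ, Nat.card_eq_fintype_card, Fintype.card_fin]
    exact_mod_cast hlt
  obtain ⟨z, -, hz⟩ := Set.exists_mem_notMem_of_ncard_lt_ncard hB
  simp only [B, Set.mem_union, Set.mem_insert_iff, Set.mem_singleton_iff, not_or, or_self] at hz
  obtain ⟨⟨⟨⟨⟨⟨⟨⟨zT, z1, z2⟩, z3, z4⟩, z5⟩, z6⟩, z7⟩, z8⟩, z9⟩, z10⟩ := hz
  have k1 : τ x0 z + τ z a = cz G x0 a := by
    by_contra hh; exact z6 ⟨zT, z1, z4, hh⟩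
  have k2 : τ a z + τ z x = cz G a x := by
    by_contra hh; exact z7 ⟨zT, z4, z2, hh⟩
  have k3 : τ x0 z + τ z b = cz G x0 b := by
    by_contra hh; exact z8 ⟨zT, z1, z5, hh⟩
  have k4 : τ b z + τ z y = cz G b y := by
    by_contra hh; exact z9 ⟨zT, z5, z3, hh⟩
  have k5 : τ x z + τ z y = cz G x y := by
    by_contra hh; exact z10 ⟨zT, z2, z3, hh⟩
  have e1 := hτ x0 hx0 x hx a a3 a1 (adj_symm a2)
  have e2 := hτ x0 hx0 y hy b b3 b1 (adj_symm b2)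
  change cz G x y = τ x0 x + τ x0 y
  rw [e1, e2, ← k1, ← k2, ← k3, ← k4, ← k5, hτs a a3 z zT, hτs b b3 z zT, hτs x hx z zT]
  generalize τ x0 z = p
  generalize τ z a = q
  generalize τ z x = r
  generalize τ z b = t
  generalize τ z y = u
  revert p q r t u; decide
end

lemma range_ncard_le {n l : ℕ} (f : Fin l ⊕ Fin l → Fin n) : (Set.range f).ncard ≤ 2 * l := by
  rw [← Set.image_univ]
  refine (Set.ncard_image_le (Set.toFinite _)).trans ?_
  rw [Set.ncard_univ, Nat.card_eq_fintype_card, Fintype.card_sum, Fintype.card_fin]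
  omega

lemma iUnion_ncard_le {n l L : ℕ} (Q : Fin l ⊕ Fin l → Set (Fin n)) (h : ∀ v, (Q v).ncard = L) :
    (⋃ v, Q v).ncard ≤ 2 * l * L := by
  classical
  have h1 : (⋃ v, Q v) = ((Finset.univ.biUnion (fun v => (Q v).toFinset) : Finset (Fin n)) :
      Set (Fin n)) := by
    ext z; simp
  rw [h1, Set.ncard_coe_finset]
  refine (Finset.card_biUnion_le_card_mul _ _ L ?_).trans ?_
  · intro v _
    rw [← h v, Set.ncard_eq_toFinset_card']
  · rw [Finset.card_univ, Fintype.card_sum, Fintype.card_fin]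
    apply le_of_eq; ring

lemma cz_blue {n : ℕ} {G : ColoredGraph n} {x y : Fin n} (h : G.blue.Adj x y) : cz G x y = 1 := by
  simp [cz, ColoredGraph.blueInd, h]

lemma cz_red {n : ℕ} {G : ColoredGraph n} {x y : Fin n} (h : G.red.Adj x y) : cz G x y = 0 := by
  have : ¬ G.blue.Adj x y := fun hb => G.disj x y ⟨h, hb⟩
  simp [cz, ColoredGraph.blueInd, this]

lemma blueBip_of_potential {n : ℕ} {G : ColoredGraph n} (A : Set (Fin n)) (ψ : Fin n → ZMod 2)
    (h : ∀ x ∈ A, ∀ y ∈ A, G.Adj x y → cz G x y = ψ x + ψ y) : G.BlueBipartiteOn A := by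
  refine ⟨{x ∈ A | ψ x = 0}, fun x hx => hx.1, ?_⟩
  intro x hx y hy
  have z2 : ∀ p q : ZMod 2, (1 = p + q → (p = 0 ↔ ¬ q = 0)) ∧ (0 = p + q → (p = 0 ↔ q = 0)) := by
    decide
  constructor
  · intro hb
    have h1 := h x hx y hy (Or.inr hb)
    rw [cz_blue hb] at h1
    have := (z2 _ _).1 h1
    simp only [Set.mem_ofPred_eq, hx, hy, true_and]
    exact this
  · intro hr
    have h1 := h x hx y hy (Or.inl hr)
    rw [cz_red hr] at h1
    have := (z2 _ _).2 h1
    simp only [Set.mem_ofPred_eq, hx, hy, true_and]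
    exact this

lemma Ctx.final {n : ℕ} {G : ColoredGraph n} {ε : ℝ} {K2 K3 : Set (Fin n)} {L s D : ℕ}
    (c : Ctx G ε K2 L s D) (hK3 : IsMaxK3 G ε K2 K3) (h1 : (K1 G ε).ncard ≤ s)
    (h2 : K2.ncard ≤ 2 * s) : G.BlueBipartiteOn (Set.univ \ (K1 G ε ∪ K2 ∪ K3)) := by
  obtain ⟨f, Q, hc, hr⟩ := hK3
  obtain ⟨T, hTdef⟩ : ∃ T, T = K1 G ε ∪ K2 ∪ Set.range f ∪ ⋃ v, Q v := ⟨_, rfl⟩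
  have hk3 := c.hk3
  have hT : 10 * T.ncard ≤ D := by
    have u1 := Set.ncard_union_le (K1 G ε ∪ K2 ∪ Set.range f) (⋃ v, Q v)
    have u2 := Set.ncard_union_le (K1 G ε ∪ K2) (Set.range f)
    have u3 := Set.ncard_union_le (K1 G ε) K2
    have u4 := range_ncard_le f
    have u5 := iUnion_ncard_le Q (L := L) (fun v => (hc.2.2.2.2.1 v).trans c.hLdef)
    rw [← hTdef] at u1
    rw [c.hDdef]
    have u6 : 2 * kappa3 G ε K2 * L ≤ 2 * s * L := by gcongr
    nlinarith
  have hKT : K1 G ε ∪ K2 ⊆ T := by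
    rw [hTdef]; exact fun z hz => Or.inl (Or.inl hz)
  have hTD : T.ncard ≤ D := by omega
  obtain ⟨φ, hφ⟩ := c.step4 hc T hTdef hT
  have hnb : ∀ x, ∃ a, x ∉ K1 G ε ∪ K2 → (G.Adj x a ∧ a ∉ T) := by
    intro x
    by_cases hx : x ∈ K1 G ε ∪ K2
    · exact ⟨x, fun h => absurd hx h⟩
    · obtain ⟨a, h1, -, h3⟩ := c.common hx hx T hTD
      exact ⟨a, fun _ => ⟨h1, h3⟩⟩
  choose m hm using hnb
  apply blueBip_of_potential _ (fun x => cz G x (m x) + φ (m x))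
  intro x hx y hy hxy
  have hx' : x ∉ K1 G ε ∪ K2 := fun h => hx.2 (Or.inl h)
  have hy' : y ∉ K1 G ε ∪ K2 := fun h => hy.2 (Or.inl h)
  obtain ⟨a, a1, a2, a3⟩ := c.common hx' hy' T hTD
  change cz G x y = (cz G x (m x) + φ (m x)) + (cz G y (m y) + φ (m y))
  rw [c.step5 T hKT hT φ hφ hx' (hm x hx').2 a3 (hm x hx').1 a1,
    c.step5 T hKT hT φ hφ hy' (hm y hy').2 a3 (hm y hy').1 a2,
    ← tri c.hG a1 (adj_symm a2) hxy, cz_symm G a y]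
  generalize cz G x a = p
  generalize cz G y a = q
  generalize φ a = r
  revert p q r; decide

/-- Lemma 3.7: there is an `ε₀ > 0` such that for every `ε ∈ (0,ε₀)` there is a `C₀`
such that for every `C ≥ C₀`, for large `n` and any maximum choices of `K2(G)` and
`K3(G)`, every `G ∈ 𝓕(n) ∖ (X0 ∪ X1 ∪ X2 ∪ X3)` has
`G - (K1(G) ∪ K2(G) ∪ K3(G))` blue-bipartite; in particular
`κ(G) ≤ κ1(G) + 2κ2(G) + 2κ3(G)`. -/
theorem remove_K_blue_bipartite :
    ∃ ε₀ : ℝ, 0 < ε₀ ∧ ∀ ε : ℝ, 0 < ε → ε < ε₀ → ∃ C₀ : ℝ, ∀ C : ℝ, C₀ ≤ C →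
      ∃ N : ℕ, ∀ n : ℕ, N ≤ n →
        ∀ K2c K3c : ColoredGraph n → Set (Fin n),
          (∀ G, IsMaxK2 G ε (K2c G)) → (∀ G, IsMaxK3 G ε (K2c G) (K3c G)) →
          ∀ G : ColoredGraph n,
            G ∈ obtfSet n \
              (X0set n ⌈C * Real.logb 2 n⌉₊ ∪ X1set n ⌈C * Real.logb 2 n⌉₊ ε ∪
                X2set n ⌈C * Real.logb 2 n⌉₊ ε C ∪
                X3set n ⌈C * Real.logb 2 n⌉₊ ε C K2c) →
            G.BlueBipartiteOn (Set.univ \ (K1 G ε ∪ K2c G ∪ K3c G)) ∧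
              G.kappa ≤ kappa1 G ε + 2 * kappa2 G ε + 2 * kappa3 G ε (K2c G) := by
  refine ⟨1 / 100, by norm_num, fun ε hε hε1 => ⟨1, fun C hC => ?_⟩⟩
  obtain ⟨N, hN⟩ := numerics ε C hε hε1 hC
  refine ⟨N, fun n hn K2c K3c hK2 hK3 G hGm => ?_⟩
  obtain ⟨n1, n2, n3, n4, n5, n6⟩ := hN n hn
  obtain ⟨hG, hX⟩ := hGm
  simp only [Set.mem_union, not_or] at hX
  obtain ⟨⟨⟨x0, x1⟩, x2⟩, x3⟩ := hX
  have k1 : kappa1 G ε < ⌈C * Real.logb 2 n⌉₊ := by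
    by_contra hc
    exact x1 ⟨hG, not_lt.1 hc⟩
  have k2 : kappa2 G ε < ⌈C * Real.logb 2 n⌉₊ := by
    by_contra hc
    exact x2 ⟨⟨hG, fun h => h.elim x0 x1⟩, not_lt.1 hc⟩
  have k3 : kappa3 G ε (K2c G) < ⌈C * Real.logb 2 n⌉₊ := by
    by_contra hc
    exact x3 ⟨⟨hG, fun h => h.elim (fun h => h.elim x0 x1) x2⟩, not_lt.1 hc⟩
  have c : Ctx G ε (K2c G) ⌈Real.logb 2 n⌉₊ ⌈C * Real.logb 2 n⌉₊
      (100 * (⌈C * Real.logb 2 n⌉₊ + 2) * (⌈Real.logb 2 n⌉₊ + 2)) :=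
    ⟨hG, hε, hε1, n1, rfl, rfl, n2, n4, n5, n6, codegree (hK2 G), k3⟩
  have b2 : (K2c G).ncard ≤ 2 * kappa2 G ε := by
    obtain ⟨f, -, hr⟩ := hK2 G
    rw [← hr]
    exact range_ncard_le f
  have b3 : (K3c G).ncard ≤ 2 * kappa3 G ε (K2c G) := by
    obtain ⟨f, Q, -, hr⟩ := hK3 G
    rw [← hr]
    exact range_ncard_le f
  have hbb := c.final (hK3 G) k1.le (by omega)
  refine ⟨hbb, ?_⟩
  have hle : G.kappa ≤ (K1 G ε ∪ K2c G ∪ K3c G).ncard := by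
    apply Nat.sInf_le
    refine ⟨_, rfl, ?_⟩
    rwa [Set.compl_eq_univ_sdiff]
  have u1 := Set.ncard_union_le (K1 G ε ∪ K2c G) (K3c G)
  have u2 := Set.ncard_union_le (K1 G ε) (K2c G)
  have u3 : kappa1 G ε = (K1 G ε).ncard := rfl
  omega
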